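/- arXiv:1403.3013 — 2 statements merged into one kernel-verified Lean document; each statement's English description precedes it below -/
import Mathlib

section
/- Let Q be a group acting by automorphisms on the free abelian group A = ℤ^k, and let σ : Q × Q → A be a 2-cocycle, i.e. g•σ(h, l) − σ(gh, l) + σ(g, hl) − σ(g, h) = 0 for all g, h, l ∈ Q. Suppose the class of σ is torsion: there exist an integer n ≥ 1 and a function t : Q → A with n•σ(g, h) = g•t(h) − t(gh) + t(g) for all g, h ∈ Q. Then there exist a finite-index subgroup Q' of Q and a function u : Q' → A such that σ(g, h) = g•u(h) − u(gh) + u(g) for all g, h ∈ Q'. -/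
/-- The elements at which `t` takes values divisible by `n`, when `t` is a crossed homomorphism
modulo `n`. -/
def divisibleSubgroup {Q A : Type*} [Group Q] [AddCommGroup A] [DistribMulAction Q A]
    {σ : Q → Q → A} {n : ℕ} {t : Q → A}
    (ht : ∀ g h : Q, n • σ g h = g • t h - t (g * h) + t g) : Subgroup Q where
  carrier := {g | ∃ a, n • a = t g}
  one_mem' := ⟨σ 1 1, by simp [ht]⟩
  mul_mem' := by
    rintro g h ⟨a, ha⟩ ⟨b, hb⟩
    refine ⟨g • b + a - σ g h, ?_⟩
    rw [smul_sub, smul_add, smul_comm n g b, ha, hb, ht]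
    abel
  inv_mem' := by
    rintro g ⟨a, ha⟩
    refine ⟨g⁻¹ • (σ g g⁻¹ + σ 1 1 - a), ?_⟩
    rw [smul_comm n, smul_sub, smul_add, ha, ht, ht, mul_inv_cancel, mul_one, one_smul,
      inv_smul_eq_iff]
    abel

/-- If `nA` has finite index in `A`, then `t` is divisible by `n` on a finite-index subgroup. -/
theorem finiteIndex_divisibleSubgroup {Q A : Type*} [Group Q] [AddCommGroup A]
    [DistribMulAction Q A] {σ : Q → Q → A} {n : ℕ} {t : Q → A}
    (ht : ∀ g h : Q, n • σ g h = g • t h - t (g * h) + t g)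
    [(nsmulAddMonoidHom (α := A) n).range.FiniteIndex] :
    (divisibleSubgroup ht).FiniteIndex := by
  let f : Q ⧸ divisibleSubgroup ht → A ⧸ (nsmulAddMonoidHom (α := A) n).range :=
    fun q ↦ (t q.out : A)
  have hf : Function.Injective f := by
    intro p q hpq
    obtain ⟨a, ha⟩ := QuotientAddGroup.eq.mp hpq
    rw [nsmulAddMonoidHom_apply] at ha
    rw [← p.out_eq', ← q.out_eq']
    refine QuotientGroup.eq.mpr ⟨p.out⁻¹ • (a + σ p.out (p.out⁻¹ * q.out)), ?_⟩
    rw [smul_comm n, smul_add, ha, ht, mul_inv_cancel_left, inv_smul_eq_iff]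
    abel
  have := Finite.of_injective f hf
  exact Subgroup.finiteIndex_of_finite_quotient

/-- If a group `Q` acts by automorphisms on the free abelian group `A = ℤ^k` and
`σ : Q × Q → A` is a 2-cocycle whose class is torsion (some positive multiple `n • σ`
is a coboundary), then `σ` becomes a coboundary after restriction to a suitable
finite-index subgroup `Q' ≤ Q`. -/
theorem torsion_two_cocycle_restricts_to_coboundary
    {Q : Type*} [Group Q] (k : ℕ) [DistribMulAction Q (Fin k → ℤ)]
    (σ : Q → Q → (Fin k → ℤ))
    (hσ : ∀ g h l : Q, g • σ h l - σ (g * h) l + σ g (h * l) - σ g h = 0)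
    (n : ℕ) (hn : 1 ≤ n) (t : Q → (Fin k → ℤ))
    (ht : ∀ g h : Q, n • σ g h = g • t h - t (g * h) + t g) :
    ∃ Q' : Subgroup Q, Q'.FiniteIndex ∧
      ∃ u : Q' → (Fin k → ℤ), ∀ g h : Q',
        σ g h = (g : Q) • u h - u (g * h) + u g := by
  have hn0 : n ≠ 0 := Nat.one_le_iff_ne_zero.mp hn
  have := AddSubgroup.finiteIndex_range_nsmulAddMonoidHom_of_fg (Fin k → ℤ) hn0
  refine ⟨divisibleSubgroup ht, finiteIndex_divisibleSubgroup ht, ?_⟩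
  have hdiv : ∀ g : divisibleSubgroup ht, ∃ a, n • a = t g := fun g ↦ g.2
  choose u hu using hdiv
  refine ⟨u, fun g h ↦ nsmul_right_injective hn0 ?_⟩
  change n • _ = n • _
  rw [smul_add, smul_sub, smul_comm n (g : Q), hu, hu, hu, ht, Subgroup.coe_mul]
end

section
/- Let 1 → A → G →π→ Q → 1 be a short exact sequence of groups in which A is a normal abelian subgroup of G isomorphic to ℤ^k, so that Q acts on A by conjugation in G. Suppose there exist a set-theoretic section s : Q → G of π (with π ∘ s = id) and an integer n ≥ 1 such that the associated 2-cocycle σ(g, h) = s(g) s(h) s(gh)⁻¹ ∈ A satisfies: n•σ is a coboundary, i.e. there is a function t : Q → A with n•σ(g, h) = (g•t(h)) − t(gh) + t(g) for all g, h ∈ Q (writing A additively, with g•a the conjugation action). Then there exists a finite-index subgroup Q' of Q such that the restricted extension 1 → A → π⁻¹(Q') → Q' → 1 splits, i.e. there is a group homomorphism s' : Q' → G with π ∘ s' = id on Q'. -/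
open scoped IsMulCommutative

/-- Elements whose images under `τ` agree lie in the same left coset of `H`; if `τ` takes finitely
many values, then `H` has finite index. -/
lemma Subgroup.finiteIndex_of_map_eq {Q X : Type*} [Group Q] [Finite X] (H : Subgroup Q)
    (τ : Q → X) (hτ : ∀ a b, τ a = τ b → a⁻¹ * b ∈ H) : H.FiniteIndex := by
  have : Finite (Q ⧸ H) := Finite.of_injective (fun x : Q ⧸ H => τ x.out) fun x y hxy => by
    rw [← x.out_eq', ← y.out_eq']
    exact QuotientGroup.eq.2 (hτ _ _ hxy)
  exact H.finiteIndex_of_finite_quotient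

/-- The image in `G` of the subgroup of `n`-th powers of a normal commutative subgroup is normal. -/
lemma Subgroup.normal_map_range_powMonoidHom {G : Type*} [Group G] (A : Subgroup G) [A.Normal]
    [IsMulCommutative A] (n : ℕ) :
    ((powMonoidHom n : A →* A).range.map A.subtype).Normal where
  conj_mem := by
    rintro _ ⟨_, ⟨a, rfl⟩, rfl⟩ g
    refine ⟨_, ⟨⟨g * a * g⁻¹, ‹A.Normal›.conj_mem _ a.2 g⟩, rfl⟩, ?_⟩
    simp [conj_pow]

/-- If the coboundary of `t` takes values in the normal subgroup `P`, then `t 1 ∈ P`. -/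
lemma one_mem_of_coboundary_mem {G Q : Type*} [Group G] [Group Q] (P : Subgroup G) [hP : P.Normal]
    (s t : Q → G)
    (h : ∀ a b : Q, (s a * t b * (s a)⁻¹) * (t (a * b))⁻¹ * t a ∈ P) : t 1 ∈ P := by
  simpa [mul_assoc] using hP.conj_mem _ (h 1 1) (s 1)⁻¹

/-- If the coboundary of `t` (with respect to a section `s`) takes values in the normal
subgroup `P`, then the elements sent by `t` into `P` form a subgroup. -/
def crossedHomPreimage {G Q : Type*} [Group G] [Group Q] (P : Subgroup G) [hP : P.Normal]
    (s t : Q → G)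
    (h : ∀ a b : Q, (s a * t b * (s a)⁻¹) * (t (a * b))⁻¹ * t a ∈ P) : Subgroup Q where
  carrier := {q | t q ∈ P}
  one_mem' := one_mem_of_coboundary_mem P s t h
  mul_mem' {a b} ha hb := by
    have hab := (P.mul_mem_cancel_right ha).1 (h a b)
    exact inv_mem_iff.1 ((P.mul_mem_cancel_left (hP.conj_mem _ hb _)).1 hab)
  inv_mem' {a} ha := by
    have h1 := one_mem_of_coboundary_mem P s t h
    have hab := (P.mul_mem_cancel_right ha).1 (h a a⁻¹)
    rw [mul_inv_cancel, P.mul_mem_cancel_right (P.inv_mem h1)] at hab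
    simpa [mul_assoc] using hP.conj_mem _ hab (s a)⁻¹

/-- A section whose cocycle is the coboundary of `u` on a subgroup `H`, with `u` valued in a
commutative subgroup `A`, can be corrected by `u` to a homomorphism on `H`. -/
def sectionHomOfCoboundary {G Q : Type*} [Group G] [Group Q] (A : Subgroup G)
    [IsMulCommutative A] (H : Subgroup Q) (s : Q → G) (u : H → A)
    (h : ∀ a b : H, s a * s b * (s (a * b))⁻¹
      = (s a * u b * (s a)⁻¹) * (u (a * b) : G)⁻¹ * u a) : H →* G :=
  MonoidHom.mk' (fun q => (u q : G)⁻¹ * s q) fun a b => by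
    have hs : s (a * b) = ((s a * u b * (s a)⁻¹) * (u (a * b) : G)⁻¹ * u a)⁻¹ * (s a * s b) := by
      rw [← h]; group
    have hc : (u a : G)⁻¹ * u (a * b) = u (a * b) * (u a : G)⁻¹ :=
      congrArg Subtype.val (mul_comm (u a)⁻¹ (u (a * b)))
    calc (u (a * b) : G)⁻¹ * s (a * b)
        = (u (a * b) : G)⁻¹ * ((u a : G)⁻¹ * u (a * b)) * (s a * (u b : G)⁻¹ * s b) := by
          rw [hs]; group
      _ = (u a : G)⁻¹ * s a * ((u b : G)⁻¹ * s b) := by rw [hc]; group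

/-- In a torsion-free commutative normal subgroup, a cocycle whose `n`-th power is the coboundary
of the `n`-th power of `u` is the coboundary of `u`. -/
lemma eq_coboundary_of_pow_eq {G : Type*} [Group G] (A : Subgroup G) [hA : A.Normal]
    [IsMulCommutative A] [IsMulTorsionFree A] {n : ℕ} (hn : n ≠ 0) {g : G} (c x y z : A)
    (h : (c : G) ^ n = (g * (x : G) ^ n * g⁻¹) * ((y : G) ^ n)⁻¹ * (z : G) ^ n) :
    (c : G) = (g * x * g⁻¹) * (y : G)⁻¹ * z := by
  let w : A := ⟨g * x * g⁻¹, hA.conj_mem _ x.2 g⟩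
  have : c = w * y⁻¹ * z := by
    apply pow_left_injective hn
    apply Subtype.ext
    simp only [mul_pow, inv_pow, Subgroup.coe_mul, Subgroup.coe_pow, Subgroup.coe_inv]
    simpa only [w, conj_pow] using h
  exact congrArg Subtype.val this


/-- Let `1 → A → G → Q → 1` be an extension of groups where `A = ker π` is a normal
abelian subgroup of `G` isomorphic to `ℤ^k` (so `Q` acts on `A` by conjugation via any
set-theoretic section `s` of `π`).  If the 2-cocycle
`σ(g, h) = s(g) s(h) s(gh)⁻¹ ∈ A` associated to `s` has `n • σ` a coboundary for some
`n ≥ 1` — i.e. there is `t : Q → A` with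
`σ(g,h)ⁿ = (s(g) t(h) s(g)⁻¹) · t(gh)⁻¹ · t(g)` for all `g, h` — then the extension
splits over some finite-index subgroup `Q' ≤ Q`: there is a group homomorphism
`s' : Q' → G` with `π ∘ s' = id`. -/
theorem extension_with_torsion_class_virtually_splits
    {G Q : Type*} [Group G] [Group Q] (π : G →* Q)
    (hsurj : Function.Surjective π)
    (A : Subgroup G) (hker : π.ker = A)
    (k : ℕ) (iso : A ≃* Multiplicative (Fin k → ℤ))
    (s : Q → G) (hs : ∀ q : Q, π (s q) = q)
    (n : ℕ) (hn : 1 ≤ n)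
    (t : Q → G) (ht : ∀ q : Q, t q ∈ A)
    (hcob : ∀ g h : Q,
      (s g * s h * (s (g * h))⁻¹) ^ n
        = (s g * t h * (s g)⁻¹) * (t (g * h))⁻¹ * t g) :
    ∃ Q' : Subgroup Q, Q'.FiniteIndex ∧
      ∃ s' : Q' →* G, ∀ q : Q', π (s' q) = (q : Q) := by
  subst hker
  have : IsMulCommutative π.ker :=
    ⟨⟨fun a b => iso.injective (by rw [map_mul, map_mul, mul_comm])⟩⟩
  have : IsMulTorsionFree π.ker :=
    Function.Injective.isMulTorsionFree iso.toMonoidHom iso.injective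
  have : Group.FG π.ker := Group.fg_of_surjective (f := iso.symm.toMonoidHom) iso.symm.surjective
  have hn0 : n ≠ 0 := Nat.one_le_iff_ne_zero.1 hn
  set R : Subgroup π.ker := (powMonoidHom n).range
  have : R.FiniteIndex := Subgroup.finiteIndex_range_powMonoidHom_of_fg _ hn0
  set P : Subgroup G := R.map π.ker.subtype
  have hP : P.Normal := π.ker.normal_map_range_powMonoidHom n
  have hσ (a b : Q) : s a * s b * (s (a * b))⁻¹ ∈ π.ker := by simp [MonoidHom.mem_ker, hs]
  have hcobP (a b : Q) : (s a * t b * (s a)⁻¹) * (t (a * b))⁻¹ * t a ∈ P :=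
    ⟨_, ⟨⟨_, hσ a b⟩, rfl⟩, hcob a b⟩
  let H : Subgroup Q := crossedHomPreimage P s t hcobP
  have hH : H.FiniteIndex := by
    refine H.finiteIndex_of_map_eq (fun q => ((⟨t q, ht q⟩ : π.ker) : π.ker ⧸ R)) fun a b hab => ?_
    have hba : (t b)⁻¹ * t a ∈ P := ⟨_, QuotientGroup.eq.1 hab.symm, rfl⟩
    have hconj := hcobP a (a⁻¹ * b)
    rw [mul_inv_cancel_left, mul_assoc, P.mul_mem_cancel_right hba] at hconj
    show t (a⁻¹ * b) ∈ P
    simpa [mul_assoc] using hP.conj_mem _ hconj (s a)⁻¹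
  have hroot (q : H) : ∃ u : π.ker, (u : G) ^ n = t q := by
    obtain ⟨_, ⟨u, rfl⟩, hu⟩ : t q ∈ P := q.2
    exact ⟨u, hu⟩
  choose u hu using hroot
  refine ⟨H, hH, sectionHomOfCoboundary π.ker H s u fun a b => ?_, fun q => ?_⟩
  · refine eq_coboundary_of_pow_eq π.ker hn0 ⟨_, hσ a b⟩ (u b) (u (a * b)) (u a) ?_
    rw [hu, hu, hu]
    exact hcob a b
  · have hq : π (u q) = 1 := (u q).2
    simp [sectionHomOfCoboundary, hq, hs]
end
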